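/- arXiv:math/0601017 — 3 statements merged into one kernel-verified Lean document; each statement's English description precedes it below -/
import Mathlib

section
/- For any integer r ≥ 2, there are infinitely many primitive covering numbers having exactly r distinct prime divisors. -/
/-- A positive integer `n` is a *covering number* if there is a finite system of
residue classes `aᵢ (mod mᵢ)` covering all of `ℤ`, whose moduli `mᵢ` are distinct,
all greater than `1`, and all divide `n`. -/
def IsCoveringNumber (n : ℕ) : Prop :=
  ∃ (k : ℕ) (a : Fin k → ℤ) (m : Fin k → ℕ),
    Function.Injective m ∧
    (∀ i, 1 < m i) ∧ (∀ i, m i ∣ n) ∧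
    (∀ x : ℤ, ∃ i, (m i : ℤ) ∣ x - a i)

/-- A covering number is *primitive* if none of its proper divisors is a covering number. -/
def IsPrimitiveCoveringNumber (n : ℕ) : Prop :=
  IsCoveringNumber n ∧ ∀ d : ℕ, d ∣ n → d ≠ n → ¬ IsCoveringNumber d

/-- An arithmetic description of covers: a choice of one residue class for every modulus
such that the classes whose modulus is a divisor `d > 1` of `n` cover `ℤ`. -/
def HasDivisorCover (n : ℕ) : Prop :=
  ∃ a : ℕ → ℤ, ∀ x : ℤ, ∃ d : ℕ, d ∣ n ∧ 1 < d ∧ (d : ℤ) ∣ x - a d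

/-- The residue classes with moduli the divisors `d > 1` of `n` can be chosen so as to cover
every integer that is not a multiple of `n`. -/
def HasAlmostCover (n : ℕ) : Prop :=
  ∃ a : ℕ → ℤ, ∀ x : ℤ, ¬ (n : ℤ) ∣ x → ∃ d : ℕ, d ∣ n ∧ 1 < d ∧ (d : ℤ) ∣ x - a d

theorem isCoveringNumber_iff_hasDivisorCover {n : ℕ} (hn : n ≠ 0) :
    IsCoveringNumber n ↔ HasDivisorCover n := by
  constructor
  · rintro ⟨k, a, m, hm, h1, hd, hc⟩
    refine ⟨Function.extend m a 0, fun x => ?_⟩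
    obtain ⟨i, hi⟩ := hc x
    exact ⟨m i, hd i, h1 i, by rwa [hm.extend_apply]⟩
  · rintro ⟨a, ha⟩
    let S := n.divisors.filter (1 < ·)
    have hS : ∀ i, ((S.equivFin.symm i : S) : ℕ) ∣ n ∧ 1 < ((S.equivFin.symm i : S) : ℕ) := by
      intro i
      have h := (S.equivFin.symm i).2
      simp only [S, Finset.mem_filter, Nat.mem_divisors] at h
      exact ⟨h.1.1, h.2⟩
    refine ⟨S.card, fun i => a (S.equivFin.symm i), fun i => (S.equivFin.symm i : S),
      Subtype.val_injective.comp S.equivFin.symm.injective,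
      fun i => (hS i).2, fun i => (hS i).1, fun x => ?_⟩
    obtain ⟨d, hdn, hd1, hdx⟩ := ha x
    have hmem : d ∈ S := by simp [S, hdn, hn, hd1]
    exact ⟨S.equivFin ⟨d, hmem⟩, by simpa using hdx⟩

theorem HasDivisorCover.mono {m n : ℕ} (h : HasDivisorCover m) (hmn : m ∣ n) :
    HasDivisorCover n := by
  obtain ⟨a, ha⟩ := h
  refine ⟨a, fun x => ?_⟩
  obtain ⟨d, hd, h1, hx⟩ := ha x
  exact ⟨d, hd.trans hmn, h1, hx⟩

theorem not_hasDivisorCover_one : ¬ HasDivisorCover 1 := by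
  rintro ⟨a, ha⟩
  obtain ⟨d, hd, h1, -⟩ := ha 0
  have := Nat.dvd_one.1 hd
  omega

theorem hasAlmostCover_one : HasAlmostCover 1 :=
  ⟨0, fun x hx => absurd (by simp) hx⟩

theorem exists_function_hitting {S T : Finset ℕ} (h : T.card ≤ S.card) :
    ∃ g : ℕ → ℕ, ∀ t ∈ T, ∃ s ∈ S, g s = t := by
  obtain ⟨U, hU, hcard⟩ := Finset.exists_subset_card_eq h
  let e : U ≃ T := Finset.equivOfCardEq hcard
  refine ⟨fun s => if hs : s ∈ U then e ⟨s, hs⟩ else 0, fun t ht => ?_⟩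
  refine ⟨e.symm ⟨t, ht⟩, hU (e.symm ⟨t, ht⟩).2, ?_⟩
  simp

/-- If the divisors of `m` are at least as many as the residues in `T`, then the moduli
`d * p ^ (j + 1)` with `d ∣ m` cover all `m * p ^ j * y` with `y % p ∈ T`, while the other moduli
keep their classes. -/
theorem HasAlmostCover.exists_extension {m p j : ℕ} (hp : p.Prime) (hpm : ¬ p ∣ m)
    (h : HasAlmostCover (m * p ^ j)) {T : Finset ℕ} (hT : T.card ≤ m.divisors.card) :
    ∃ a : ℕ → ℤ, ∀ x : ℤ,
      (∀ y : ℤ, x = (m * p ^ j : ℕ) * y → ∃ i ∈ T, (p : ℤ) ∣ y - i) →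
      ∃ d : ℕ, d ∣ m * p ^ (j + 1) ∧ 1 < d ∧ (d : ℤ) ∣ x - a d := by
  obtain ⟨a, ha⟩ := h
  obtain ⟨g, hg⟩ := exists_function_hitting hT
  refine ⟨fun e => if e ∣ m * p ^ j then a e else (m * p ^ j : ℕ) * (g (e / p ^ (j + 1)) : ℤ),
    fun x hx => ?_⟩
  by_cases hdvd : ((m * p ^ j : ℕ) : ℤ) ∣ x
  · obtain ⟨y, rfl⟩ := hdvd
    obtain ⟨i, hi, hpy⟩ := hx y rfl
    obtain ⟨d, hd, rfl⟩ := hg i hi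
    have hdm : d ∣ m := Nat.dvd_of_mem_divisors hd
    have hpos : 0 < p ^ (j + 1) := pow_pos hp.pos _
    have hnot : ¬ d * p ^ (j + 1) ∣ m * p ^ j := by
      intro hcon
      have h1 : p ^ j * p ∣ p ^ j * m := by
        rw [← pow_succ, mul_comm (p ^ j) m]
        exact (Dvd.intro_left _ rfl).trans hcon
      exact hpm (Nat.dvd_of_mul_dvd_mul_left (pow_pos hp.pos _) h1)
    refine ⟨d * p ^ (j + 1), mul_dvd_mul_right hdm _, ?_, ?_⟩
    · have h1 : 1 < p ^ (j + 1) := Nat.one_lt_pow (by omega) hp.one_lt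
      have h2 : 0 < d := Nat.pos_of_mem_divisors hd
      nlinarith
    · simp only [if_neg hnot, Nat.mul_div_cancel _ hpos]
      rw [← mul_sub]
      obtain ⟨z, hz⟩ := hpy
      obtain ⟨w, hw⟩ := hdm
      rw [hz, hw]
      refine ⟨w * z, ?_⟩
      push_cast
      ring_nf
  · obtain ⟨d, hd, h1, hdx⟩ := ha x hdvd
    refine ⟨d, hd.trans (mul_dvd_mul_left _ (pow_dvd_pow _ (Nat.le_succ j))), h1, ?_⟩
    simpa only [if_pos hd] using hdx

theorem exists_residue_dvd_sub {p : ℕ} (hp : 0 < p) (y : ℤ) :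
    ∃ i < p, (p : ℤ) ∣ y - (i : ℕ) := by
  have hp' : (0 : ℤ) < p := by exact_mod_cast hp
  have h1 := Int.emod_nonneg y hp'.ne'
  have h2 := Int.emod_lt_of_pos y hp'
  refine ⟨(y % p).toNat, by omega, ?_⟩
  rw [Int.toNat_of_nonneg h1]
  exact Int.dvd_self_sub_emod

theorem HasAlmostCover.mul_prime_pow {m p : ℕ} (hp : p.Prime) (hpm : ¬ p ∣ m)
    (h : HasAlmostCover m) (hcard : p ≤ m.divisors.card + 1) (j : ℕ) :
    HasAlmostCover (m * p ^ j) := by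
  induction j with
  | zero => simpa using h
  | succ j ih =>
    obtain ⟨a, ha⟩ := ih.exists_extension hp hpm (T := Finset.Ioo 0 p)
      (by rw [Nat.card_Ioo]; omega)
    refine ⟨a, fun x hx => ha x ?_⟩
    rintro y rfl
    obtain ⟨i, hi, hdvd⟩ := exists_residue_dvd_sub hp.pos y
    refine ⟨i, Finset.mem_Ioo.2 ⟨Nat.pos_of_ne_zero ?_, hi⟩, hdvd⟩
    rintro rfl
    refine hx ?_
    rw [pow_succ, ← mul_assoc, Nat.cast_mul]
    exact mul_dvd_mul_left _ (by simpa using hdvd)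

theorem HasAlmostCover.hasDivisorCover_mul_prime {m p : ℕ} (hp : p.Prime)
    (hpm : ¬ p ∣ m) (h : HasAlmostCover m) (hcard : p ≤ m.divisors.card) :
    HasDivisorCover (m * p) := by
  have h0 : HasAlmostCover (m * p ^ 0) := by simpa using h
  obtain ⟨a, ha⟩ := h0.exists_extension hp hpm (T := Finset.range p) (by simpa using hcard)
  refine ⟨a, fun x => ?_⟩
  simp only [zero_add, pow_one] at ha
  refine ha x fun y _ => ?_
  obtain ⟨i, hi, hdvd⟩ := exists_residue_dvd_sub hp.pos y
  exact ⟨i, Finset.mem_range.2 hi, hdvd⟩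

/-- If `m` has fewer than `p` divisors, some residue class modulo `p ^ A` avoids all the classes
with moduli `d * p ^ j`, where `d ∣ m` and `1 ≤ j ≤ A`. -/
theorem exists_residue_avoiding {m p : ℕ} (hp : p.Prime) (hm : m ≠ 0)
    (hcard : m.divisors.card < p) (a : ℕ → ℤ) (A : ℕ) :
    ∃ c : ℤ, ∀ d, d ∣ m → ∀ j, 1 ≤ j → j ≤ A → ¬ ((p ^ j : ℕ) : ℤ) ∣ c - a (d * p ^ j) := by
  induction A with
  | zero => exact ⟨0, fun d _ j h1 h2 => by omega⟩
  | succ A ih =>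
    obtain ⟨c, hc⟩ := ih
    have key : ∃ i < p, ∀ d, d ∣ m →
        ¬ ((p ^ (A + 1) : ℕ) : ℤ) ∣ c + (p ^ A : ℕ) * (i : ℤ) - a (d * p ^ (A + 1)) := by
      by_contra! hcon
      choose! f hf hdvd using hcon
      have hle : (Finset.range p).card ≤ m.divisors.card := by
        refine Finset.card_le_card_of_injOn f
          (fun i hi => Nat.mem_divisors.2 ⟨hf i (Finset.mem_range.1 hi), hm⟩) ?_
        intro i hi i' hi' hii
        have hi : i < p := by simpa using hi
        have hi' : i' < p := by simpa using hi'
        have h1 := hdvd i hi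
        have h2 := hdvd i' hi'
        rw [← hii] at h2
        have h3 := Int.dvd_sub h1 h2
        have h4 : ((p ^ A : ℕ) : ℤ) * p ∣ (p ^ A : ℕ) * ((i : ℤ) - i') := by
          convert h3 using 1
          · push_cast; ring
          · ring
        have h5 : (p : ℤ) ∣ (i : ℤ) - i' :=
          (mul_dvd_mul_iff_left (by exact_mod_cast (pow_pos hp.pos A).ne')).1 h4
        have h6 : (i : ℤ) - i' = 0 :=
          Int.eq_zero_of_abs_lt_dvd h5 (by rw [abs_lt]; constructor <;> omega)
        omega
      rw [Finset.card_range] at hle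
      omega
    obtain ⟨i, -, hi⟩ := key
    refine ⟨c + (p ^ A : ℕ) * (i : ℤ), fun d hd j h1 h2 => ?_⟩
    rcases h2.eq_or_lt with rfl | h2
    · exact hi d hd
    · intro hcon
      refine hc d hd j h1 (by omega) ?_
      have h3 : ((p ^ j : ℕ) : ℤ) ∣ (p ^ A : ℕ) * (i : ℤ) :=
        (Int.natCast_dvd_natCast.2 (pow_dvd_pow p (by omega))).mul_right _
      have h4 := Int.dvd_sub hcon h3
      convert h4 using 1
      ring

theorem HasDivisorCover.of_mul_prime_pow {m p A : ℕ} (hp : p.Prime) (hm : m ≠ 0) (hpm : ¬ p ∣ m)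
    (hcard : m.divisors.card < p) (h : HasDivisorCover (m * p ^ A)) : HasDivisorCover m := by
  obtain ⟨a, ha⟩ := h
  obtain ⟨c, hc⟩ := exists_residue_avoiding hp hm hcard a A
  refine ⟨a, fun x => ?_⟩
  have hcop : IsCoprime (m : ℤ) ((p ^ A : ℕ) : ℤ) :=
    Nat.isCoprime_iff_coprime.2 (((Nat.Prime.coprime_iff_not_dvd hp).2 hpm).symm.pow_right A)
  obtain ⟨u, v, huv⟩ := hcop
  have hyx : (m : ℤ) ∣ x - (x + u * m * (c - x)) := ⟨-(u * (c - x)), by ring⟩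
  have hyc : ((p ^ A : ℕ) : ℤ) ∣ c - (x + u * m * (c - x)) :=
    ⟨v * (c - x), by linear_combination (-(c - x)) * huv⟩
  generalize x + u * m * (c - x) = y at hyx hyc
  obtain ⟨e, he, h1, hy⟩ := ha y
  obtain ⟨d, w, hd, hw, rfl⟩ := exists_dvd_and_dvd_of_dvd_mul he
  obtain ⟨j, hj, rfl⟩ := (Nat.dvd_prime_pow hp).1 hw
  rcases Nat.eq_zero_or_pos j with rfl | hj0
  · simp only [pow_zero, mul_one] at h1 hy
    refine ⟨d, hd, h1, ?_⟩
    have h2 := Int.dvd_add ((Int.natCast_dvd_natCast.2 hd).trans hyx) hy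
    convert h2 using 1
    ring
  · refine absurd ?_ (hc d hd j hj0 hj)
    have h2 := Int.dvd_add ((Int.natCast_dvd_natCast.2 (pow_dvd_pow p hj)).trans hyc)
      ((Int.natCast_dvd_natCast.2 (Dvd.intro_left d rfl)).trans hy)
    convert h2 using 1
    ring

theorem card_divisors_mul_prime_pow {m p : ℕ} (hp : p.Prime) (hpm : ¬ p ∣ m) (A : ℕ) :
    (m * p ^ A).divisors.card = m.divisors.card * (A + 1) := by
  rw [Nat.Coprime.card_divisors_mul (((Nat.Prime.coprime_iff_not_dvd hp).2 hpm).symm.pow_right A),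
    Nat.divisors_prime_pow hp, Finset.card_map, Finset.card_range]

theorem card_primeFactors_mul_prime_pow {m p A : ℕ} (hp : p.Prime) (hpm : ¬ p ∣ m) (hA : A ≠ 0) :
    (m * p ^ A).primeFactors.card = m.primeFactors.card + 1 := by
  rw [Nat.Coprime.primeFactors_mul
      (((Nat.Prime.coprime_iff_not_dvd hp).2 hpm).symm.pow_right A),
    Nat.primeFactors_prime_pow hA hp, Finset.card_union_of_disjoint, Finset.card_singleton]
  simp [hpm]

theorem exists_prime_gt_eq_mul_add_one (N : ℕ) {k : ℕ} (hk : k ≠ 0) :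
    ∃ p : ℕ, p.Prime ∧ N < p ∧ ∃ b, p = k * b + 1 := by
  obtain ⟨p, hp, hN, hmod⟩ := Nat.exists_prime_gt_modEq_one N hk
  obtain ⟨b, hb⟩ := (Nat.modEq_iff_dvd' hp.one_lt.le).1 hmod.symm
  have := hp.one_lt
  exact ⟨p, hp, hN, b, by omega⟩

/-- There are numbers with any prescribed number of prime factors that are not covering numbers
but allow covers of all integers outside one class, and whose number of divisors is one less than
a new prime. -/
theorem exists_hasAlmostCover_not_hasDivisorCover (k : ℕ) :
    ∃ m : ℕ, m ≠ 0 ∧ m.primeFactors.card = k ∧ HasAlmostCover m ∧ ¬ HasDivisorCover m ∧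
      (m.divisors.card + 1).Prime ∧ ¬ m.divisors.card + 1 ∣ m := by
  induction k with
  | zero =>
    exact ⟨1, one_ne_zero, by simp, hasAlmostCover_one, not_hasDivisorCover_one,
      by norm_num, by norm_num⟩
  | succ k ih =>
    obtain ⟨m, hm, hk, hac, hnc, hp, hpm⟩ := ih
    have hpos : 0 < m.divisors.card := Finset.card_pos.2 (Nat.nonempty_divisors.2 hm)
    obtain ⟨q, hq, hlt, b, hb⟩ :=
      exists_prime_gt_eq_mul_add_one (m + m.divisors.card + 1) hpos.ne'
    obtain ⟨A, rfl⟩ : ∃ A, b = A + 1 + 1 := by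
      rcases b with _ | _ | A
      · omega
      · omega
      · exact ⟨A, rfl⟩
    have hq' : (m * (m.divisors.card + 1) ^ (A + 1)).divisors.card + 1 = q := by
      rw [card_divisors_mul_prime_pow hp hpm, hb]
    refine ⟨m * (m.divisors.card + 1) ^ (A + 1), mul_ne_zero hm (pow_ne_zero _ hp.ne_zero),
      by rw [card_primeFactors_mul_prime_pow hp hpm (by omega), hk],
      hac.mul_prime_pow hp hpm le_rfl _,
      fun hc => hnc (hc.of_mul_prime_pow hp hm hpm (Nat.lt_succ_self _)), ?_, ?_⟩
    · rwa [hq']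
    · rw [hq']
      intro hdvd
      rcases (Nat.Prime.dvd_mul hq).1 hdvd with h | h
      · have := Nat.le_of_dvd (Nat.pos_of_ne_zero hm) h
        omega
      · have := Nat.le_of_dvd hp.pos (hq.dvd_of_dvd_pow h)
        omega

theorem exists_isPrimitiveCoveringNumber_dvd {n : ℕ} (h : IsCoveringNumber n) (hn : n ≠ 0) :
    ∃ d, d ∣ n ∧ IsPrimitiveCoveringNumber d := by
  induction n using Nat.strong_induction_on with
  | _ n ih =>
    by_cases hprim : IsPrimitiveCoveringNumber n
    · exact ⟨n, dvd_rfl, hprim⟩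
    · simp only [IsPrimitiveCoveringNumber, h, true_and] at hprim
      push Not at hprim
      obtain ⟨d, hd, hne, hc⟩ := hprim
      obtain ⟨e, he, hpe⟩ := ih d (lt_of_le_of_ne (Nat.le_of_dvd (Nat.pos_of_ne_zero hn) hd) hne)
        hc (ne_zero_of_dvd_ne_zero hn hd)
      exact ⟨e, he.trans hd, hpe⟩

/-- A prime factor can be removed from a multiple of `d` if it does not divide `d`, and this at
least halves the number of divisors. -/
theorem exists_two_mul_card_divisors_le {m l : ℕ} (hm : m ≠ 0) (hl : l.Prime) (hlm : l ∣ m) :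
    ∃ m', m' ∣ m ∧ 2 * m'.divisors.card ≤ m.divisors.card ∧
      ∀ d t : ℕ, ¬ l ∣ d → d ∣ m * t → d ∣ m' * t := by
  obtain ⟨e, m', hm', rfl⟩ := Nat.exists_eq_pow_mul_and_not_dvd hm l hl.ne_one
  have he : e ≠ 0 := by
    rintro rfl
    exact hm' (by simpa using hlm)
  refine ⟨m', Dvd.intro_left _ rfl, ?_, fun d t hd hdt => ?_⟩
  · rw [mul_comm (l ^ e), card_divisors_mul_prime_pow hl hm', mul_comm 2]
    exact Nat.mul_le_mul_left _ (by omega)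
  · rw [mul_assoc] at hdt
    exact (((Nat.Prime.coprime_iff_not_dvd hl).2 hd).symm.pow_right e).dvd_of_dvd_mul_left hdt

theorem stmt5 (r : ℕ) (hr : 2 ≤ r) :
    {n : ℕ | IsPrimitiveCoveringNumber n ∧ n.primeFactors.card = r}.Infinite := by
  refine Set.infinite_of_forall_exists_gt fun N => ?_
  obtain ⟨m, hm, hk, hac, hnc, hp, hpm⟩ := exists_hasAlmostCover_not_hasDivisorCover (r - 2)
  have hpos : 0 < m.divisors.card := Finset.card_pos.2 (Nat.nonempty_divisors.2 hm)
  obtain ⟨q, hqle, hq⟩ := Nat.exists_infinite_primes (N + m + m.divisors.card + 2)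
  obtain ⟨A, hA0, hA1, hA2⟩ : ∃ A : ℕ, A ≠ 0 ∧ q ≤ m.divisors.card * (A + 1) ∧
      m.divisors.card * A < q := by
    have hdiv := Nat.div_add_mod (q - 1) m.divisors.card
    have hmod := Nat.mod_lt (q - 1) hpos
    refine ⟨(q - 1) / m.divisors.card, ?_, ?_, ?_⟩
    · exact (Nat.div_pos (by omega) hpos).ne'
    · rw [mul_add, mul_one]; omega
    · omega
  generalize hpdef : m.divisors.card + 1 = p at hp hpm
  have hM : m * p ^ A ≠ 0 := mul_ne_zero hm (pow_ne_zero _ hp.ne_zero)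
  have hqm : ¬ q ∣ m := fun h => by
    have := Nat.le_of_dvd (Nat.pos_of_ne_zero hm) h
    omega
  have hqp : ¬ q ∣ p ^ A := fun h => by
    have := Nat.le_of_dvd hp.pos (hq.dvd_of_dvd_pow h)
    omega
  have hqM : ¬ q ∣ m * p ^ A := fun h => ((Nat.Prime.dvd_mul hq).1 h).elim hqm hqp
  have hMnc : ¬ HasDivisorCover (m * p ^ A) :=
    fun h => hnc (h.of_mul_prime_pow hp hm hpm (by omega))
  have hcov : HasDivisorCover (m * p ^ A * q) := by
    refine (hac.mul_prime_pow hp hpm (by omega) A).hasDivisorCover_mul_prime hq hqM ?_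
    rwa [card_divisors_mul_prime_pow hp hpm]
  have hn : m * p ^ A * q ≠ 0 := mul_ne_zero hM hq.ne_zero
  obtain ⟨d, hd, hprim⟩ := exists_isPrimitiveCoveringNumber_dvd
    ((isCoveringNumber_iff_hasDivisorCover hn).2 hcov) hn
  have hd0 : d ≠ 0 := ne_zero_of_dvd_ne_zero hn hd
  have hdcov : HasDivisorCover d := (isCoveringNumber_iff_hasDivisorCover hd0).1 hprim.1
  have hqd : q ∣ d := by
    by_contra h
    exact hMnc (hdcov.mono
      (((Nat.Prime.coprime_iff_not_dvd hq).2 h).symm.dvd_of_dvd_mul_right hd))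
  have hpd : p ∣ d := by
    by_contra h
    have h1 : d ∣ m * q ^ 1 := by
      refine (((Nat.Prime.coprime_iff_not_dvd hp).2 h).symm.pow_right A).dvd_of_dvd_mul_right ?_
      rwa [pow_one, mul_right_comm]
    exact hnc ((hdcov.mono h1).of_mul_prime_pow hq hm hqm (by omega))
  have hld : ∀ l, l.Prime → l ∣ m → l ∣ d := by
    intro l hl hlm
    by_contra h
    obtain ⟨m', hm'm, hcard, hrem⟩ := exists_two_mul_card_divisors_le hm hl hlm
    have h1 : d ∣ m' * p ^ A * q ^ 1 := by
      rw [pow_one, mul_assoc]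
      exact hrem d _ h (by rwa [← mul_assoc])
    have hM'M : m' * p ^ A ∣ m * p ^ A := mul_dvd_mul_right hm'm _
    refine hMnc (((hdcov.mono h1).of_mul_prime_pow hq (ne_zero_of_dvd_ne_zero hM hM'M)
      (fun h => hqM (h.trans hM'M)) ?_).mono hM'M)
    rw [card_divisors_mul_prime_pow hp (fun h => hpm (h.trans hm'm))]
    nlinarith [Nat.mul_le_mul_right (A + 1) hcard]
  have hfac : d.primeFactors = (m * p ^ A * q ^ 1).primeFactors := by
    rw [pow_one]
    refine (Nat.primeFactors_mono hd hn).antisymm fun l hl => ?_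
    have hl' := Nat.prime_of_mem_primeFactors hl
    refine Nat.mem_primeFactors.2 ⟨hl', ?_, hd0⟩
    rcases (Nat.Prime.dvd_mul hl').1 (Nat.dvd_of_mem_primeFactors hl) with h | h
    · rcases (Nat.Prime.dvd_mul hl').1 h with h | h
      · exact hld l hl' h
      · rwa [(Nat.prime_dvd_prime_iff_eq hl' hp).1 (hl'.dvd_of_dvd_pow h)]
    · rwa [(Nat.prime_dvd_prime_iff_eq hl' hq).1 h]
  refine ⟨d, ⟨hprim, ?_⟩, ?_⟩
  · rw [hfac, card_primeFactors_mul_prime_pow hq hqM one_ne_zero,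
      card_primeFactors_mul_prime_pow hp hpm hA0, hk]
    omega
  · have := Nat.le_of_dvd (Nat.pos_of_ne_zero hd0) hqd
    omega
end

section
/- An integer n > 1 having at most two distinct prime divisors is a primitive covering number if and only if n = 2^{p−1} · p for some odd prime p. -/
/-- Finitely many residue classes whose densities sum to less than `1` miss some integer. -/
theorem exists_forall_not_dvd_sub {ι : Type*} (s : Finset ι) (m : ι → ℕ) (c : ι → ℤ)
    (hm : ∀ i ∈ s, 0 < m i) (hs : ∑ i ∈ s, (1 / m i : ℚ) < 1) :
    ∃ x : ℤ, ∀ i ∈ s, ¬ (m i : ℤ) ∣ x - c i := by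
  classical
  by_contra! hcov
  set N : ℕ := ∏ i ∈ s, m i with hN
  have hN0 : 0 < N := Finset.prod_pos hm
  have hcard : ∀ i ∈ s,
      (((Finset.Ico (0 : ℤ) N).filter (fun x => x ≡ c i [ZMOD m i])).card : ℚ)
        = N * (1 / m i : ℚ) := by
    intro i hi
    obtain ⟨t, ht⟩ := Finset.dvd_prod_of_mem m hi
    have hmi : (0 : ℤ) < m i := by exact_mod_cast hm i hi
    have hmq : (m i : ℚ) ≠ 0 := by exact_mod_cast (hm i hi).ne'
    have hNt : (N : ℚ) = m i * t := by rw [hN, ht]; push_cast; ring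
    have key := Int.Ico_filter_modEq_card (0 : ℤ) N hmi (c i)
    have e : (((N : ℤ) - c i : ℤ) / ((m i : ℤ) : ℚ) : ℚ) =
        (((0 : ℤ) - c i : ℤ) / ((m i : ℤ) : ℚ) : ℚ) + (t : ℤ) := by
      push_cast
      rw [hNt]
      field_simp
      ring
    have key' : (((Finset.Ico (0 : ℤ) N).filter (fun x => x ≡ c i [ZMOD m i])).card : ℤ)
        = t := by
      rw [key]
      push_cast at e ⊢
      rw [e, show (t : ℚ) = ((t : ℤ) : ℚ) by simp, Int.ceil_add_intCast]
      simp
    rw [show (((Finset.Ico (0 : ℤ) N).filter (fun x => x ≡ c i [ZMOD m i])).card : ℚ) = t by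
      exact_mod_cast key', hNt]
    field_simp
  have hsub : Finset.Ico (0 : ℤ) N ⊆
      s.biUnion fun i => (Finset.Ico (0 : ℤ) N).filter (fun x => x ≡ c i [ZMOD m i]) := by
    intro x hx
    obtain ⟨i, hi, hd⟩ := hcov x
    simp only [Finset.mem_biUnion, Finset.mem_filter]
    exact ⟨i, hi, hx, (Int.modEq_iff_dvd.2 hd).symm⟩
  have hle := (Finset.card_le_card hsub).trans Finset.card_biUnion_le
  rw [Int.card_Ico, sub_zero, Int.toNat_natCast] at hle
  have hle' : (N : ℚ) ≤ ∑ i ∈ s, (N : ℚ) * (1 / m i : ℚ) := by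
    rw [← Finset.sum_congr rfl hcard]
    exact_mod_cast hle
  rw [← Finset.mul_sum] at hle'
  have hNq : (0 : ℚ) < N := by exact_mod_cast hN0
  nlinarith

theorem isCoveringNumber_iff {n : ℕ} (hn : n ≠ 0) :
    IsCoveringNumber n ↔
      ∃ c : ℕ → ℤ, ∀ x : ℤ, ∃ d : ℕ, 1 < d ∧ d ∣ n ∧ (d : ℤ) ∣ x - c d := by
  constructor
  · rintro ⟨k, a, m, hinj, h1, hd, hcov⟩
    refine ⟨Function.extend m a 0, fun x => ?_⟩
    obtain ⟨i, hi⟩ := hcov x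
    exact ⟨m i, h1 i, hd i, by rwa [hinj.extend_apply]⟩
  · rintro ⟨c, hc⟩
    let s := n.divisors.filter (1 < ·)
    let e := s.equivFin.symm
    have hs : ∀ i, 1 < (e i : ℕ) ∧ (e i : ℕ) ∣ n := fun i => by
      have := (e i).2
      simp only [s, Finset.mem_filter, Nat.mem_divisors] at this
      exact ⟨this.2, this.1.1⟩
    refine ⟨s.card, fun i => c (e i), fun i => e i, Subtype.val_injective.comp e.injective,
      fun i => (hs i).1, fun i => (hs i).2, fun x => ?_⟩
    obtain ⟨d, h1, hd, hx⟩ := hc x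
    have hmem : d ∈ s := by simp [s, h1, hd, hn]
    exact ⟨e.symm ⟨d, hmem⟩, by simpa using hx⟩

theorem sum_one_div_pow_succ {q : ℕ} (hq : 0 < q) (b : ℕ) :
    ((q : ℚ) - 1) * ∑ j ∈ Finset.range b, (1 / (q : ℚ) ^ (j + 1)) = 1 - 1 / (q : ℚ) ^ b := by
  have hq' : (q : ℚ) ≠ 0 := by exact_mod_cast hq.ne'
  induction b with
  | zero => simp
  | succ b ih =>
    rw [Finset.sum_range_succ, mul_add, ih]
    field_simp
    ring

theorem mul_sum_one_div_pow_succ_lt_one {q : ℕ} (hq : 0 < q) (b : ℕ) :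
    ((q : ℚ) - 1) * ∑ j ∈ Finset.range b, (1 / (q : ℚ) ^ (j + 1)) < 1 := by
  have hq' : (0 : ℚ) < q := by exact_mod_cast hq
  rw [sum_one_div_pow_succ hq]
  have : 0 < 1 / (q : ℚ) ^ b := by positivity
  linarith

theorem not_isCoveringNumber_two_pow_mul_prime_pow {a b q : ℕ} (hq : q.Prime)
    (haq : a + 2 ≤ q) : ¬ IsCoveringNumber (2 ^ a * q ^ b) := by
  have hq0 := hq.pos
  rw [isCoveringNumber_iff (by positivity)]
  rintro ⟨c, hc⟩
  obtain ⟨r, hr⟩ := exists_forall_not_dvd_sub (Finset.range a) (fun i => 2 ^ (i + 1))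
    (fun i => c (2 ^ (i + 1))) (fun i _ => by positivity) (by
      have := mul_sum_one_div_pow_succ_lt_one (q := 2) (by norm_num) a
      norm_num at this ⊢
      linarith)
  have hcop : IsCoprime ((2 : ℤ) ^ a) ((q : ℤ) ^ b) := by
    rcases Nat.eq_zero_or_pos a with rfl | ha
    · simpa using isCoprime_one_left
    · have : Nat.Coprime (2 ^ a) (q ^ b) := by
        apply Nat.Coprime.pow
        rw [Nat.coprime_primes Nat.prime_two hq]
        omega
      exact_mod_cast Nat.isCoprime_iff_coprime.2 this
  obtain ⟨u, v, huv⟩ := hcop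
  obtain ⟨y, hy⟩ := exists_forall_not_dvd_sub (Finset.range (a + 1) ×ˢ Finset.range b)
    (fun ij => q ^ (ij.2 + 1)) (fun ij => u * (c (2 ^ ij.1 * q ^ (ij.2 + 1)) - r))
    (fun ij _ => by positivity) (by
      rw [Finset.sum_product]
      simp only [Nat.cast_pow, Finset.sum_const, Finset.card_range, nsmul_eq_mul]
      have h1 := mul_sum_one_div_pow_succ_lt_one hq0 b
      have h2 : 0 ≤ ∑ j ∈ Finset.range b, (1 / (q : ℚ) ^ (j + 1)) :=
        Finset.sum_nonneg fun _ _ => by positivity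
      have h3 : ((a : ℚ) + 2) ≤ q := by exact_mod_cast haq
      push_cast
      nlinarith)
  obtain ⟨d, h1, hd, hx⟩ := hc (r + 2 ^ a * y)
  obtain ⟨d₁, d₂, hd₁, hd₂, rfl⟩ := (Nat.dvd_mul).1 hd
  obtain ⟨i, hi, rfl⟩ := (Nat.dvd_prime_pow Nat.prime_two).1 hd₁
  obtain ⟨j, hj, rfl⟩ := (Nat.dvd_prime_pow hq).1 hd₂
  rcases j with _ | j
  · rcases i with _ | i
    · simp at h1
    · refine hr i (Finset.mem_range.2 hi) ?_
      simp only [pow_zero, mul_one] at hx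
      have h2 : ((2 ^ (i + 1) : ℕ) : ℤ) ∣ 2 ^ a * y := by
        push_cast
        exact (pow_dvd_pow 2 hi).mul_right y
      have h3 := dvd_sub hx h2
      rwa [show r + 2 ^ a * y - c (2 ^ (i + 1)) - 2 ^ a * y = r - c (2 ^ (i + 1)) by ring] at h3
  · refine hy (i, j) (by simp; omega) ?_
    have h2 : ((q ^ (j + 1) : ℕ) : ℤ) ∣ r + 2 ^ a * y - c (2 ^ i * q ^ (j + 1)) :=
      (by push_cast; exact dvd_mul_left _ _ :
        ((q ^ (j + 1) : ℕ) : ℤ) ∣ ((2 ^ i * q ^ (j + 1) : ℕ) : ℤ)).trans hx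
    have h3 : ((q ^ (j + 1) : ℕ) : ℤ) ∣ (q : ℤ) ^ b := by
      push_cast
      exact pow_dvd_pow _ hj
    have h4 := (h2.mul_left u).add (h3.mul_left (v * y))
    rwa [show u * (r + 2 ^ a * y - c (2 ^ i * q ^ (j + 1))) + v * y * (q : ℤ) ^ b =
      y - u * (c (2 ^ i * q ^ (j + 1)) - r) by linear_combination y * huv] at h4

theorem not_isCoveringNumber_mul_of_odd_primes {a b p q : ℕ} (hp : p.Prime) (hq : q.Prime)
    (hp3 : 3 ≤ p) (hq5 : 5 ≤ q) : ¬ IsCoveringNumber (p ^ a * q ^ b) := by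
  have hp0 := hp.pos
  have hq0 := hq.pos
  rw [isCoveringNumber_iff (by positivity)]
  rintro ⟨c, hc⟩
  obtain ⟨x, hx⟩ := exists_forall_not_dvd_sub
    ((Finset.range (a + 1) ×ˢ Finset.range (b + 1)).erase (0, 0))
    (fun ij => p ^ ij.1 * q ^ ij.2) (fun ij => c (p ^ ij.1 * q ^ ij.2))
    (fun ij _ => by positivity) (by
      rw [Finset.sum_erase_eq_sub (by simp), Finset.sum_product]
      simp only [Nat.cast_mul, Nat.cast_pow, one_div, mul_inv]
      rw [← Finset.sum_mul_sum, Finset.sum_range_succ', Finset.sum_range_succ']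
      have h1 := mul_sum_one_div_pow_succ_lt_one hp0 a
      have h2 := mul_sum_one_div_pow_succ_lt_one hq0 b
      simp only [one_div] at h1 h2
      have h3 : 0 ≤ ∑ j ∈ Finset.range a, ((p : ℚ) ^ (j + 1))⁻¹ :=
        Finset.sum_nonneg fun _ _ => by positivity
      have h4 : 0 ≤ ∑ j ∈ Finset.range b, ((q : ℚ) ^ (j + 1))⁻¹ :=
        Finset.sum_nonneg fun _ _ => by positivity
      have h5 : (3 : ℚ) ≤ p := by exact_mod_cast hp3
      have h6 : (5 : ℚ) ≤ q := by exact_mod_cast hq5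
      generalize ∑ j ∈ Finset.range a, ((p : ℚ) ^ (j + 1))⁻¹ = S at *
      generalize ∑ j ∈ Finset.range b, ((q : ℚ) ^ (j + 1))⁻¹ = T at *
      have hS : S < 1 / 2 := by nlinarith
      have hT : T < 1 / 4 := by nlinarith
      simp only [pow_zero, inv_one, mul_one]
      nlinarith)
  obtain ⟨d, h1, hd, hxd⟩ := hc x
  obtain ⟨d₁, d₂, hd₁, hd₂, rfl⟩ := (Nat.dvd_mul).1 hd
  obtain ⟨i, hi, rfl⟩ := (Nat.dvd_prime_pow hp).1 hd₁
  obtain ⟨j, hj, rfl⟩ := (Nat.dvd_prime_pow hq).1 hd₂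
  refine hx (i, j) ?_ hxd
  simp only [Finset.mem_erase, ne_eq, Prod.mk.injEq, Finset.mem_product, Finset.mem_range]
  refine ⟨?_, by omega, by omega⟩
  rintro ⟨rfl, rfl⟩
  simp at h1

theorem exists_two_pow_succ_dvd_sub {k : ℕ} {x : ℤ} (h : ¬ (2 : ℤ) ^ k ∣ x) :
    ∃ i < k, (2 : ℤ) ^ (i + 1) ∣ x - 2 ^ i := by
  induction k with
  | zero => simp at h
  | succ k ih =>
    by_cases hk : (2 : ℤ) ^ k ∣ x
    · refine ⟨k, k.lt_succ_self, ?_⟩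
      obtain ⟨y, rfl⟩ := hk
      rw [pow_succ, show (2 : ℤ) ^ k * y - 2 ^ k = 2 ^ k * (y - 1) by ring]
      rw [pow_succ] at h
      refine mul_dvd_mul_left _ ?_
      have : ¬ (2 : ℤ) ∣ y := fun hy => h (mul_dvd_mul_left _ hy)
      omega
    · obtain ⟨i, hi, hd⟩ := ih hk
      exact ⟨i, by omega, hd⟩

theorem isCoveringNumber_two_pow_mul_prime {p : ℕ} (hp : p.Prime) (hodd : Odd p) :
    IsCoveringNumber (2 ^ (p - 1) * p) := by
  have hp0 := hp.pos
  have hcop : Nat.Coprime p 2 := hodd.coprime_two_right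
  rw [isCoveringNumber_iff (by positivity)]
  refine ⟨fun d => if p ∣ d then (Nat.log 2 (d / p) : ℤ) * 2 ^ (p - 1) else ((d / 2 : ℕ) : ℤ),
    fun x => ?_⟩
  by_cases hx : (2 : ℤ) ^ (p - 1) ∣ x
  · have hi0 : 0 ≤ x % p := Int.emod_nonneg _ (by exact_mod_cast hp0.ne')
    have hi1 : x % p < p := Int.emod_lt_of_pos _ (by exact_mod_cast hp0)
    obtain ⟨i, hi⟩ := Int.eq_ofNat_of_zero_le hi0
    have hip : i ≤ p - 1 := by omega
    have hpow : (2 : ℤ) ^ i ∣ 2 ^ (p - 1) := pow_dvd_pow _ hip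
    refine ⟨2 ^ i * p, ?_, mul_dvd_mul_right (pow_dvd_pow 2 hip) p, ?_⟩
    · exact hp.one_lt.trans_le (Nat.le_mul_of_pos_left _ (by positivity))
    · beta_reduce
      rw [if_pos (dvd_mul_left _ _), Nat.mul_div_cancel _ hp0, Nat.log_pow Nat.one_lt_two]
      push_cast
      refine IsCoprime.mul_dvd ?_ (dvd_sub (hpow.trans hx) (hpow.mul_left _)) ?_
      · exact_mod_cast Nat.isCoprime_iff_coprime.2 (hcop.symm.pow_left i)
      · have hF : (2 : ℤ) ^ (p - 1) ≡ 1 [ZMOD p] :=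
          Int.ModEq.pow_card_sub_one_eq_one hp (by
            exact_mod_cast Nat.isCoprime_iff_coprime.2 hcop.symm)
        have h1 : (i : ℤ) * 2 ^ (p - 1) ≡ x [ZMOD p] := by
          calc (i : ℤ) * 2 ^ (p - 1) ≡ i * 1 [ZMOD p] := hF.mul_left _
            _ = x % p := by rw [hi, mul_one]
            _ ≡ x [ZMOD p] := Int.mod_modEq _ _
        exact h1.dvd
  · obtain ⟨i, hi, hd⟩ := exists_two_pow_succ_dvd_sub hx
    refine ⟨2 ^ (i + 1), Nat.one_lt_two_pow (by omega), (pow_dvd_pow 2 hi).mul_right p, ?_⟩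
    have hnd : ¬ p ∣ 2 ^ (i + 1) := fun h =>
      hp.one_lt.ne' (Nat.Coprime.eq_one_of_dvd (hcop.pow_right _) h)
    beta_reduce
    rw [if_neg hnd, pow_succ, Nat.mul_div_cancel _ two_pos]
    push_cast
    rwa [← pow_succ]

theorem not_isCoveringNumber_prime_pow {q : ℕ} (hq : q.Prime) (b : ℕ) :
    ¬ IsCoveringNumber (q ^ b) := by
  simpa using not_isCoveringNumber_two_pow_mul_prime_pow (a := 0) (b := b) hq hq.two_le

theorem exists_two_pow_mul_prime_dvd {n : ℕ} (hn : 1 < n) (h : n.primeFactors.card ≤ 2)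
    (hc : IsCoveringNumber n) : ∃ p : ℕ, p.Prime ∧ Odd p ∧ 2 ^ (p - 1) * p ∣ n := by
  have hfac := Nat.prod_primeFactors_pow_factorization (n := n) (by omega)
  have hpos : 0 < n.primeFactors.card := Finset.card_pos.2 (Nat.nonempty_primeFactors.2 hn)
  obtain h1 | h2 : n.primeFactors.card = 1 ∨ n.primeFactors.card = 2 := by omega
  · obtain ⟨q, hq⟩ := Finset.card_eq_one.1 h1
    have hqp : q.Prime := Nat.prime_of_mem_primeFactors (by rw [hq]; simp : q ∈ n.primeFactors)
    rw [hq, Finset.prod_singleton] at hfac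
    rw [hfac] at hc
    exact absurd hc (not_isCoveringNumber_prime_pow hqp _)
  · obtain ⟨p, q, hpq, hs⟩ := Finset.card_eq_two.1 h2
    wlog hlt : p < q generalizing p q
    · exact this q p hpq.symm (by rw [hs, Finset.pair_comm]) (by omega)
    have hpm : p ∈ n.primeFactors := by simp [hs]
    have hqm : q ∈ n.primeFactors := by simp [hs]
    have hp := Nat.prime_of_mem_primeFactors hpm
    have hq := Nat.prime_of_mem_primeFactors hqm
    rw [hs, Finset.prod_pair hpq] at hfac
    have hqodd : Odd q := hq.odd_of_ne_two (by have := hp.two_le; omega)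
    rw [hfac] at hc
    rcases hp.eq_two_or_odd' with rfl | hpodd
    · have ha : q - 1 ≤ n.factorization 2 := by
        by_contra! hlt
        exact not_isCoveringNumber_two_pow_mul_prime_pow hq (by omega) hc
      refine ⟨q, hq, hqodd, ?_⟩
      rw [hfac]
      exact mul_dvd_mul (pow_dvd_pow 2 ha) (dvd_pow_self q
        (hq.factorization_pos_of_dvd (by omega) (Nat.dvd_of_mem_primeFactors hqm)).ne')
    · have hp2 := hp.two_le
      obtain ⟨k, rfl⟩ := hpodd
      obtain ⟨l, rfl⟩ := hqodd
      exact absurd hc (not_isCoveringNumber_mul_of_odd_primes hp hq (by omega) (by omega))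

theorem stmt6 (n : ℕ) (hn : 1 < n) (h : n.primeFactors.card ≤ 2) :
    IsPrimitiveCoveringNumber n ↔
      ∃ p : ℕ, p.Prime ∧ Odd p ∧ n = 2 ^ (p - 1) * p := by
  constructor
  · rintro ⟨hc, hmin⟩
    obtain ⟨p, hp, hodd, hd⟩ := exists_two_pow_mul_prime_dvd hn h hc
    refine ⟨p, hp, hodd, ?_⟩
    by_contra hne
    exact hmin _ hd (Ne.symm hne) (isCoveringNumber_two_pow_mul_prime hp hodd)
  · rintro ⟨p, hp, hodd, rfl⟩
    refine ⟨isCoveringNumber_two_pow_mul_prime hp hodd, fun d hd hne hc => ?_⟩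
    obtain ⟨d₁, d₂, hd₁, hd₂, rfl⟩ := (Nat.dvd_mul).1 hd
    obtain ⟨i, hi, rfl⟩ := (Nat.dvd_prime_pow Nat.prime_two).1 hd₁
    rcases (Nat.dvd_prime hp).1 hd₂ with rfl | rfl
    · rw [mul_one] at hc
      exact not_isCoveringNumber_prime_pow Nat.prime_two i hc
    · have hi' : i ≠ d₂ - 1 := fun h => hne (by rw [h])
      have hlt : i + 2 ≤ d₂ := by omega
      exact not_isCoveringNumber_two_pow_mul_prime_pow (b := 1) hp hlt (by rwa [pow_one])
end

section
/- The number 12 is a covering number (witnessed by the cover {0 (mod 2), 0 (mod 3), 1 (mod 4), 5 (mod 6), 7 (mod 12)} of ℤ), and no positive integer less than 12 is a covering number. -/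
/-- A cover with distinct moduli dividing `n` can be indexed by the divisors of `n` other
than `1`, with arbitrary residues assigned to the divisors that do not occur. -/
theorem IsCoveringNumber.exists_residue {n : ℕ} (hn : n ≠ 0) (h : IsCoveringNumber n) :
    ∃ b : ℕ → ℤ, ∀ x : ℤ, ∃ d ∈ n.divisors.erase 1, (d : ℤ) ∣ x - b d := by
  obtain ⟨k, a, m, hinj, hone, hdvd, hcover⟩ := h
  refine ⟨Function.extend m a 0, fun x => ?_⟩
  obtain ⟨i, hi⟩ := hcover x
  refine ⟨m i, ?_, by rwa [hinj.extend_apply]⟩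
  simp [hdvd i, hn, (hone i).ne']

theorem Nat.Prime.not_isCoveringNumber {p : ℕ} (hp : p.Prime) : ¬ IsCoveringNumber p := by
  intro h
  obtain ⟨b, hb⟩ := h.exists_residue hp.ne_zero
  obtain ⟨d, hd, hdvd⟩ := hb (b p + 1)
  obtain ⟨hd1, hd⟩ := Finset.mem_erase.mp hd
  obtain rfl := (hp.eq_one_or_self_of_dvd d (Nat.dvd_of_mem_divisors hd)).resolve_left hd1
  rw [add_sub_cancel_left] at hdvd
  exact hd1 (by exact_mod_cast Int.eq_one_of_dvd_one (Int.natCast_nonneg d) hdvd)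

theorem not_isCoveringNumber_of_lt_twelve {m : ℕ} (hpos : 0 < m) (hlt : m < 12) :
    ¬ IsCoveringNumber m := by
  by_cases hp : m.Prime
  · exact hp.not_isCoveringNumber
  intro h
  obtain ⟨b, hb⟩ := h.exists_residue hpos.ne'
  have hm : m = 1 ∨ m = 4 ∨ m = 6 ∨ m = 8 ∨ m = 9 ∨ m = 10 := by
    interval_cases m <;> first | omega | exact absurd (by norm_num) hp
  clear hp h
  rcases hm with rfl | rfl | rfl | rfl | rfl | rfl
  · simpa using hb 0
  · simp [show Nat.divisors 4 = {1, 2, 4} by decide] at hb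
    have h₁ := hb (b 2 + 1)
    have h₂ := hb (b 2 + 3)
    omega
  · simp [show Nat.divisors 6 = {1, 2, 3, 6} by decide] at hb
    have h₁ := hb (3 * (b 2 + 1) + 4 * (b 3 + 1))
    have h₂ := hb (3 * (b 2 + 1) + 4 * (b 3 + 2))
    omega
  · simp [show Nat.divisors 8 = {1, 2, 4, 8} by decide] at hb
    have h₁ := hb (b 2 + 1)
    have h₂ := hb (b 2 + 3)
    have h₃ := hb (b 2 + 5)
    have h₄ := hb (b 2 + 7)
    omega
  · simp [show Nat.divisors 9 = {1, 3, 9} by decide] at hb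
    have h₁ := hb (b 3 + 1)
    have h₂ := hb (b 3 + 2)
    omega
  · simp [show Nat.divisors 10 = {1, 2, 5, 10} by decide] at hb
    have h₁ := hb (5 * (b 2 + 1) + 6 * (b 5 + 1))
    have h₂ := hb (5 * (b 2 + 1) + 6 * (b 5 + 2))
    omega

theorem stmt18 :
    (∀ x : ℤ, (2 : ℤ) ∣ x ∨ (3 : ℤ) ∣ x ∨ (4 : ℤ) ∣ x - 1 ∨
      (6 : ℤ) ∣ x - 5 ∨ (12 : ℤ) ∣ x - 7) ∧
    IsCoveringNumber 12 ∧
    ∀ m : ℕ, 0 < m → m < 12 → ¬ IsCoveringNumber m := by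
  have hcover : ∀ x : ℤ, (2 : ℤ) ∣ x ∨ (3 : ℤ) ∣ x ∨ (4 : ℤ) ∣ x - 1 ∨
      (6 : ℤ) ∣ x - 5 ∨ (12 : ℤ) ∣ x - 7 := by
    intro x
    obtain h | h | h : x % 3 = 0 ∨ x % 3 = 1 ∨ x % 3 = 2 := by omega
    all_goals omega
  refine ⟨hcover, ⟨5, ![0, 0, 1, 5, 7], ![2, 3, 4, 6, 12], by decide, by decide, by decide,
    fun x => ?_⟩, fun m => not_isCoveringNumber_of_lt_twelve⟩
  simpa [Fin.exists_fin_succ] using hcover x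
end
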